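/- Let p ≥ 3 be an integer and let f = (f_{i,j}) be an infinite frieze pattern of type Λ_p. Call an integer b saturated if there exist integers i < b < j with f_{i,j} = 1, and non-saturated otherwise. If some integer is non-saturated, then the set of non-saturated integers is unbounded above and unbounded below; that is, either all integers are saturated or there are infinitely many non-saturated integers in both directions. -/

import Mathlib

/-- `lam p = λ_p = 2 cos (π / p)`. -/
noncomputable def lam (p : ℕ) : ℝ := 2 * Real.cos (Real.pi / p)

/-- An infinite frieze pattern. -/
def IsInfFrieze (f : ℤ → ℤ → ℝ) : Prop :=
  (∀ i : ℤ, f i i = 0) ∧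
  (∀ i : ℤ, f i (i + 1) = 1) ∧
  (∀ i j : ℤ, i + 1 ≤ j → 0 < f i j) ∧
  (∀ i j : ℤ, i + 1 ≤ j → f i j * f (i + 1) (j + 1) - f i (j + 1) * f (i + 1) j = 1)

/-- The frieze pattern is of type `Λ_p`. -/
def IsTypeLambda (p : ℕ) (f : ℤ → ℤ → ℝ) : Prop :=
  ∀ i : ℤ, ∃ n : ℕ, 0 < n ∧ f i (i + 2) = n * lam p

/-- `b` is saturated for `f` if it lies strictly below an arc of `Θ(F)`. -/
def Saturated (f : ℤ → ℤ → ℝ) (b : ℤ) : Prop :=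
  ∃ i j : ℤ, i < b ∧ b < j ∧ f i j = 1

/-- normalised Chebyshev values `sin (k θ) / sin θ`, `θ = π / p`. -/
noncomputable def sinQ (p : ℕ) (k : ℕ) : ℝ := Real.sin (k * (Real.pi / p)) / Real.sin (Real.pi / p)

lemma sin_base_pos (p : ℕ) (hp : 3 ≤ p) : 0 < Real.sin (Real.pi / p) := by
  have hp' : (3:ℝ) ≤ p := by exact_mod_cast hp
  apply Real.sin_pos_of_pos_of_lt_pi
  · have := Real.pi_pos
    positivity
  · apply div_lt_self Real.pi_pos
    linarith

lemma sinQ_zero (p : ℕ) : sinQ p 0 = 0 := by simp [sinQ]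

lemma sinQ_one (p : ℕ) (hp : 3 ≤ p) : sinQ p 1 = 1 := by
  have := sin_base_pos p hp
  simp [sinQ, this.ne']

lemma sinQ_rec (p : ℕ) (k : ℕ) : sinQ p (k + 2) = lam p * sinQ p (k + 1) - sinQ p k := by
  simp only [sinQ, lam]
  generalize Real.pi / (p:ℝ) = t
  rw [mul_div_assoc', ← sub_div]
  congr 1
  have h1 : ((k + 2 : ℕ) : ℝ) * t = ((k+1 : ℕ) : ℝ) * t + t := by push_cast; ring
  have h2 : (k : ℝ) * t = ((k+1 : ℕ) : ℝ) * t - t := by push_cast; ring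
  rw [h1, h2, Real.sin_add, Real.sin_sub]
  ring

lemma sinQ_p (p : ℕ) (hp : 3 ≤ p) : sinQ p p = 0 := by
  have hp' : (p:ℝ) ≠ 0 := by positivity
  simp [sinQ, mul_div_cancel₀, hp']

lemma sinQ_pred (p m : ℕ) (hp : 3 ≤ p) (hm : m + 1 = p) : sinQ p m = 1 := by
  have h0 := sin_base_pos p hp
  have hp' : (p:ℝ) ≠ 0 := by positivity
  have : (m : ℝ) * (Real.pi / p) = Real.pi - Real.pi / p := by
    have : (m : ℝ) = p - 1 := by rw [← hm]; push_cast; ring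
    rw [this]; field_simp
  rw [sinQ, this, Real.sin_pi_sub, div_self h0.ne']

lemma sinQ_ge (p k : ℕ) (hp : 3 ≤ p) (hk : 1 ≤ k) (hk' : k + 1 ≤ p) : 1 ≤ sinQ p k := by
  have h0 := sin_base_pos p hp
  have hp' : (0:ℝ) < p := by positivity
  rw [sinQ, le_div_iff₀ h0, one_mul, ← sub_nonneg, Real.sin_sub_sin]
  have hpi := Real.pi_pos
  have hk1 : (1:ℝ) ≤ k := by exact_mod_cast hk
  have hk2 : (k:ℝ) + 1 ≤ p := by exact_mod_cast hk'
  set t := Real.pi / (p:ℝ) with ht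
  have htp : 0 < t := by positivity
  have hpt : p * t = Real.pi := by rw [ht]; field_simp
  have h1 : 0 ≤ Real.sin ((k * t - t) / 2) := by
    apply Real.sin_nonneg_of_nonneg_of_le_pi <;> nlinarith
  have h2 : 0 ≤ Real.cos ((k * t + t) / 2) := by
    apply Real.cos_nonneg_of_neg_pi_div_two_le_of_le <;> nlinarith
  positivity

/-- zero or at least one -/
def ZO (x : ℝ) : Prop := x = 0 ∨ 1 ≤ x

lemma ZO.nonneg {x : ℝ} (h : ZO x) : 0 ≤ x := by
  rcases h with h | h <;> linarith

lemma ZO.add {x y : ℝ} (hx : ZO x) (hy : ZO y) : ZO (x + y) := by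
  have h1 := hx.nonneg
  have h2 := hy.nonneg
  rcases hx with h | h
  · subst h; simpa using hy
  · right; linarith

lemma ZO.mul {x y : ℝ} (hx : ZO x) (hy : ZO y) : ZO (x * y) := by
  rcases hx with h | h
  · left; simp [h]
  · rcases hy with h' | h'
    · left; simp [h']
    · right; nlinarith

lemma sinQ_ZO (p k : ℕ) (hp : 3 ≤ p) (hk : k ≤ p) : ZO (sinQ p k) := by
  rcases Nat.eq_zero_or_pos k with h | h
  · left; rw [h, sinQ_zero]
  · rcases hk.eq_or_lt with h' | h'
    · left; rw [h', sinQ_p p hp]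
    · right; exact sinQ_ge p k hp h h'

/-- Rows of products of the nonnegative generators of the Hecke group. -/
inductive Row (p : ℕ) : ℝ → ℝ → Prop
  | e1 : Row p 1 0
  | e2 : Row p 0 1
  | step (u v : ℝ) (k : ℕ) (hk : k + 2 ≤ p) (h : Row p u v) :
      Row p (u * sinQ p (k + 1) + v * sinQ p k) (u * sinQ p (k + 2) + v * sinQ p (k + 1))

lemma Row.zo {p : ℕ} (hp : 3 ≤ p) {x y : ℝ} (h : Row p x y) : ZO x ∧ ZO y := by
  induction h with
  | e1 => exact ⟨Or.inr le_rfl, Or.inl rfl⟩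
  | e2 => exact ⟨Or.inl rfl, Or.inr le_rfl⟩
  | step u v k hk h ih =>
    have a := sinQ_ZO p k hp (by omega)
    have b := sinQ_ZO p (k+1) hp (by omega)
    have c := sinQ_ZO p (k+2) hp (by omega)
    exact ⟨(ih.1.mul b).add (ih.2.mul a), (ih.1.mul c).add (ih.2.mul b)⟩

/-- The orbit: rows of Hecke group elements. -/
def Orb (p : ℕ) (a b : ℝ) : Prop :=
  Row p a b ∨ Row p (-a) (-b) ∨ Row p (-b) a ∨ Row p b (-a)

lemma Orb.neg {p : ℕ} {a b : ℝ} (h : Orb p a b) : Orb p (-a) (-b) := by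
  unfold Orb at *
  simp only [neg_neg]
  tauto

lemma Orb.rot {p : ℕ} {a b : ℝ} (h : Orb p a b) : Orb p b (-a) := by
  unfold Orb at *
  simp only [neg_neg]
  tauto

lemma Row.shear {p : ℕ} (hp : 3 ≤ p) {x y : ℝ} (h : Row p x y) : Row p x (y + lam p * x) := by
  have := Row.step x y 0 (by omega) h
  have h2 := sinQ_rec p 0
  simp only [zero_add, sinQ_zero, sinQ_one p hp] at this h2
  rw [h2] at this
  convert this using 1 <;> ring

lemma Row.shear' {p : ℕ} (hp : 3 ≤ p) {x y : ℝ} (h : Row p x y) :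
    Orb p y (-x + lam p * y) := by
  cases h with
  | e1 =>
    right; left
    convert Row.e2 (p := p) using 1 <;> ring
  | e2 =>
    left
    convert (Row.e1 (p := p)).shear hp using 1; ring
  | step u v k hk h =>
    have r1 := sinQ_rec p k
    have r2 := sinQ_rec p (k+1)
    rcases hk.eq_or_lt with h' | h'
    · have e1 : sinQ p (k+2) = 0 := by rw [h']; exact sinQ_p p hp
      have e2 : sinQ p (k+1) = 1 := sinQ_pred p (k+1) hp h'
      rw [e1, e2] at r1
      right; right; left
      have : sinQ p k = lam p := by linarith
      rw [e1, e2, this]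
      convert h using 1 <;> ring
    · left
      have := Row.step u v (k+1) h' h
      convert this using 1
      rw [r2, r1]; ring

lemma Orb.shear {p : ℕ} (hp : 3 ≤ p) {a b : ℝ} (h : Orb p a b) : Orb p a (b + lam p * a) := by
  rcases h with h | h | h | h
  · exact Or.inl (h.shear hp)
  · have := h.shear hp
    right; left
    convert this using 1; ring
  · have := h.shear' hp
    convert this using 1; ring
  · have := (h.shear' hp).neg
    convert this using 1 <;> ring

lemma Orb.shear_n {p : ℕ} (hp : 3 ≤ p) {a b : ℝ} (h : Orb p a b) (n : ℕ) :
    Orb p a (b + n * lam p * a) := by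
  induction n with
  | zero => simpa using h
  | succ n ih =>
    have := ih.shear hp
    convert this using 1; push_cast; ring

lemma Orb.ge_one {p : ℕ} (hp : 3 ≤ p) {a b : ℝ} (h : Orb p a b) (ha : 0 < a) : 1 ≤ a := by
  rcases h with h | h | h | h
  · have := (h.zo hp).1
    unfold ZO at this; rcases this with h | h <;> linarith
  · have := (h.zo hp).1
    unfold ZO at this; rcases this with h | h <;> linarith
  · have := (h.zo hp).2
    unfold ZO at this; rcases this with h | h <;> linarith
  · have := (h.zo hp).2
    unfold ZO at this; rcases this with h | h <;> linarith

/-- linear recurrence along rows -/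
lemma frieze_rec {f : ℤ → ℤ → ℝ} (hf : IsInfFrieze f) (j : ℤ) (i : ℤ) (hij : i ≤ j) :
    f i (j + 2) = f j (j + 2) * f i (j + 1) - f i j := by
  obtain ⟨h0, h1, hpos, hu⟩ := hf
  induction i, hij using Int.leInductionDown with
  | base => rw [h0, h1]; ring
  | pred i hi ih =>
    have a := hu (i - 1) j (by omega)
    have b := hu (i - 1) (j + 1) (by omega)
    have c := hpos i (j + 1) (by omega)
    simp only [sub_add_cancel, show j + 1 + 1 = j + 2 by ring] at a b
    rw [ih] at b
    apply mul_right_cancel₀ c.ne'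
    linear_combination a - b

lemma frieze_orb {p : ℕ} (hp : 3 ≤ p) {f : ℤ → ℤ → ℝ} (hf : IsInfFrieze f)
    (hl : IsTypeLambda p f) (i j : ℤ) (hij : i ≤ j) : Orb p (f i j) (f i (j + 1)) := by
  induction j, hij using Int.leInduction with
  | base => rw [hf.1, hf.2.1]; exact Or.inl Row.e2
  | succ j hj ih =>
    obtain ⟨n, -, hn⟩ := hl j
    rw [show j + 1 + 1 = j + 2 by ring, frieze_rec hf j i hj, hn]
    have := ih.rot.shear_n hp n
    convert this using 1; ring

lemma frieze_ge_one {p : ℕ} (hp : 3 ≤ p) {f : ℤ → ℤ → ℝ} (hf : IsInfFrieze f)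
    (hl : IsTypeLambda p f) (i j : ℤ) (hij : i < j) : 1 ≤ f i j :=
  (frieze_orb hp hf hl i j hij.le).ge_one hp (hf.2.2.1 i j hij)

lemma frieze_wronsk {f : ℤ → ℤ → ℝ} (hf : IsInfFrieze f) (i k j : ℤ) (hik : i ≤ k)
    (hkj : k ≤ j) : f i j * f k (j + 1) - f i (j + 1) * f k j = f i k := by
  induction j, hkj using Int.leInduction with
  | base => rw [hf.1, hf.2.1]; ring
  | succ j hj ih =>
    rw [show j + 1 + 1 = j + 2 by ring, frieze_rec hf j i (by omega), frieze_rec hf j k hj]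
    linear_combination ih

lemma frieze_ptolemy {f : ℤ → ℤ → ℝ} (hf : IsInfFrieze f) (i k j l : ℤ) (hik : i ≤ k)
    (hkj : k ≤ j) (hjl : j ≤ l) :
    f i j * f k l = f i k * f j l + f i l * f k j := by
  suffices h : f i j * f k l = f i k * f j l + f i l * f k j ∧
      f i j * f k (l+1) = f i k * f j (l+1) + f i (l+1) * f k j from h.1
  induction l, hjl using Int.leInduction with
  | base =>
    have := frieze_wronsk hf i k j hik hkj
    rw [hf.1, hf.2.1]
    exact ⟨by ring, by linarith⟩
  | succ l hl ih =>
    refine ⟨ih.2, ?_⟩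
    rw [show l + 1 + 1 = l + 2 by ring, frieze_rec hf l i (by omega),
      frieze_rec hf l k (by omega), frieze_rec hf l j hl]
    linear_combination f l (l+2) * ih.2 - ih.1

lemma right_side (p : ℕ) (hp : 3 ≤ p) (f : ℤ → ℤ → ℝ)
    (hf : IsInfFrieze f) (hl : IsTypeLambda p f)
    (h : ∃ b : ℤ, ¬ Saturated f b) :
    ∀ N : ℤ, ∃ b : ℤ, N < b ∧ ¬ Saturated f b := by
  by_contra! hcon
  obtain ⟨N, hN⟩ := hcon
  obtain ⟨b, hb, hmax⟩ := Int.exists_greatest_of_bdd (P := fun b => ¬ Saturated f b)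
    ⟨N, fun z hz => by
      by_contra hlt
      exact hz (hN z (by omega))⟩ h
  have hsat : ∀ c, b < c → Saturated f c := by
    intro c hc
    by_contra hns
    have := hmax c hns
    omega
  have ge := frieze_ge_one hp hf hl
  have next : ∀ j, b < j → f b j = 1 → ∃ l, j < l ∧ f b l = 1 := by
    intro j hj hfj
    obtain ⟨i, l, hi, hjl, hil⟩ := hsat j hj
    have hbi : b ≤ i := by
      by_contra hlt
      exact hb ⟨i, l, by omega, by omega, hil⟩
    rcases hbi.eq_or_lt with h' | h'
    · subst h'; exact ⟨l, hjl, hil⟩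
    · exfalso
      have pt := frieze_ptolemy hf b i j l (by omega) (by omega) (by omega)
      rw [hfj, hil] at pt
      have a1 := ge b i h'
      have a2 := ge j l hjl
      have a3 := ge b l (by omega)
      have a4 := ge i j hi
      nlinarith
  have key : ∀ n : ℕ, ∃ j, b < j ∧ f b j = 1 ∧ f (b - 1) j ≤ f (b - 1) (b + 1) - n := by
    intro n
    induction n with
    | zero => exact ⟨b + 1, by omega, hf.2.1 b, by simp⟩
    | succ n ih =>
      obtain ⟨j, hj, hfj, hle⟩ := ih
      obtain ⟨l, hjl, hfl⟩ := next j hj hfj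
      refine ⟨l, by omega, hfl, ?_⟩
      have pt := frieze_ptolemy hf (b - 1) b j l (by omega) (by omega) (by omega)
      have e := hf.2.1 (b - 1)
      rw [sub_add_cancel] at e
      rw [hfj, hfl, e] at pt
      have := ge j l hjl
      push_cast
      linarith
  obtain ⟨n, hn⟩ := exists_nat_gt (f (b - 1) (b + 1))
  obtain ⟨j, hj, -, hle⟩ := key n
  have := hf.2.2.1 (b - 1) j (by omega)
  linarith

lemma refl_sat {f : ℤ → ℤ → ℝ} (b : ℤ) :
    Saturated (fun i j => f (-j) (-i)) b ↔ Saturated f (-b) := by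
  constructor
  · rintro ⟨i, j, h1, h2, h3⟩
    exact ⟨-j, -i, by omega, by omega, h3⟩
  · rintro ⟨i, j, h1, h2, h3⟩
    exact ⟨-j, -i, by omega, by omega, by simpa using h3⟩

lemma refl_frieze {f : ℤ → ℤ → ℝ} (hf : IsInfFrieze f) :
    IsInfFrieze (fun i j => f (-j) (-i)) := by
  obtain ⟨h0, h1, hpos, hu⟩ := hf
  refine ⟨fun i => h0 _, fun i => ?_, fun i j hij => hpos _ _ (by omega), fun i j hij => ?_⟩
  · have := h1 (-(i+1))
    rwa [show -(i+1) + 1 = -i by ring] at this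
  · have := hu (-(j+1)) (-(i+1)) (by omega)
    rw [show -(i+1) + 1 = -i by ring, show -(j+1) + 1 = -j by ring] at this
    simp only
    linarith

lemma refl_type {p : ℕ} {f : ℤ → ℤ → ℝ} (hl : IsTypeLambda p f) :
    IsTypeLambda p (fun i j => f (-j) (-i)) := by
  intro i
  obtain ⟨n, hn, h⟩ := hl (-(i+2))
  rw [show -(i+2) + 2 = -i by ring] at h
  exact ⟨n, hn, h⟩

/-- If some integer is non-saturated, then there are non-saturated integers arbitrarily far
to the right and arbitrarily far to the left. -/
theorem infFrieze_nonsaturated_unbounded (p : ℕ) (hp : 3 ≤ p) (f : ℤ → ℤ → ℝ)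
    (hf : IsInfFrieze f) (hl : IsTypeLambda p f)
    (h : ∃ b : ℤ, ¬ Saturated f b) :
    (∀ N : ℤ, ∃ b : ℤ, N < b ∧ ¬ Saturated f b) ∧
    (∀ N : ℤ, ∃ b : ℤ, b < N ∧ ¬ Saturated f b) := by
  refine ⟨right_side p hp f hf hl h, fun N => ?_⟩
  obtain ⟨b, hb⟩ := h
  obtain ⟨c, hc, hc'⟩ := right_side p hp _ (refl_frieze hf) (refl_type hl)
    ⟨-b, by rw [refl_sat, neg_neg]; exact hb⟩ (-N)
  rw [refl_sat] at hc'
  exact ⟨-c, by omega, hc'⟩
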